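/- Suppose the combined input z = (u, w) satisfies condition (C1): ∫₀^{+∞} |z(t)| dt < ∞, and the switching interaction graph G_{σ(t)} is uniformly jointly L-connected (UJLC). Then the system achieves global set tracking with respect to ℒ(y(t)), i.e. lim_{t→∞} |x(t)|_{ℒ(y(t))} = 0 for all initial conditions. -/

import Mathlib

open Metric Set Filter MeasureTheory

noncomputable section

/-- Data of the multi-agent system (5): the switching communication topology
(neighbor sets `Nb`, leader sets `Ld`), the weight functions `A` (= `a_{ij}`),
`B` (= `b_{ij}`), the dwell time `τD` and the weight bounds `aLo = a_*`,
`aHi = a^*`, `bLo = b_*`, together with Assumptions 1 and 2. -/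
structure MASData (d n k : ℕ) where
  hn : 2 ≤ n
  hk : 1 ≤ k
  Nb : ℝ → Fin n → Finset (Fin n)
  Ld : ℝ → Fin n → Finset (Fin k)
  A : Fin n → Fin n → (Fin n → EuclideanSpace ℝ (Fin d)) →
    (Fin k → EuclideanSpace ℝ (Fin d)) → ℝ → ℝ
  B : Fin n → Fin k → (Fin n → EuclideanSpace ℝ (Fin d)) →
    (Fin k → EuclideanSpace ℝ (Fin d)) → ℝ → ℝ
  τD : ℝ
  aLo : ℝ
  aHi : ℝ
  bLo : ℝ
  τD_pos : 0 < τD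
  aLo_pos : 0 < aLo
  bLo_pos : 0 < bLo
  A_bdd : ∀ i j xv yv t, aLo ≤ A i j xv yv t ∧ A i j xv yv t ≤ aHi
  B_bdd : ∀ i j xv yv t, bLo ≤ B i j xv yv t
  A_cont : ∀ i j, Continuous fun p :
    (Fin n → EuclideanSpace ℝ (Fin d)) × (Fin k → EuclideanSpace ℝ (Fin d)) × ℝ =>
    A i j p.1 p.2.1 p.2.2
  B_cont : ∀ i j, Continuous fun p :
    (Fin n → EuclideanSpace ℝ (Fin d)) × (Fin k → EuclideanSpace ℝ (Fin d)) × ℝ =>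
    B i j p.1 p.2.1 p.2.2
  /-- The topology is piecewise constant with consecutive switching instants
  separated by at least the dwell time `τD` (Assumption 1). -/
  dwell : ∃ s : ℕ → ℝ, s 0 = 0 ∧ (∀ m : ℕ, s m + τD ≤ s (m + 1)) ∧
    ∀ m : ℕ, ∀ t₁ ∈ Set.Ico (s m) (s (m + 1)), ∀ t₂ ∈ Set.Ico (s m) (s (m + 1)),
      Nb t₁ = Nb t₂ ∧ Ld t₁ = Ld t₂

namespace MASData

variable {d n k : ℕ}

/-- The arc relation of the communication graph at time `t`, on the node set
`Fin k ⊕ Fin n` (leaders ⊕ followers).  `arcAt t v v'` means there is an arc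
leaving `v` and entering `v'`; there are no arcs from followers into leaders. -/
def arcAt (D : MASData d n k) (t : ℝ) (v v' : Fin k ⊕ Fin n) : Prop :=
  match v, v' with
  | Sum.inl j, Sum.inr i => j ∈ D.Ld t i
  | Sum.inr j, Sum.inr i => j ∈ D.Nb t i
  | _, _ => False

/-- Arc relation of the union graph over the set of times `T`. -/
def arcOn (D : MASData d n k) (T : Set ℝ) (v v' : Fin k ⊕ Fin n) : Prop :=
  ∃ t ∈ T, D.arcAt t v v'

/-- The union graph over the set of times `T` is L-connected: every follower is
reachable from some leader by a directed path. -/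
def LConnectedOn (D : MASData d n k) (T : Set ℝ) : Prop :=
  ∀ i : Fin n, ∃ j : Fin k, Relation.ReflTransGen (D.arcOn T) (Sum.inl j) (Sum.inr i)

/-- Uniformly jointly L-connected. -/
def UJLC (D : MASData d n k) : Prop :=
  ∃ T > (0:ℝ), ∀ t ≥ (0:ℝ), D.LConnectedOn (Set.Ico t (t + T))

/-- Jointly L-connected. -/
def JLC (D : MASData d n k) : Prop :=
  ∀ t ≥ (0:ℝ), D.LConnectedOn (Set.Ici t)

end MASData

/-- A solution (trajectory) of system (5) together with its inputs: leader
controls `u`, disturbances `w`, follower states `x` and leader states `y`;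
the dynamics hold in the sense of right derivatives for `t ≥ 0`, and the
(piecewise continuous) inputs are locally interval integrable along the
solution. -/
structure MASSol {d n k : ℕ} (D : MASData d n k) where
  x : ℝ → Fin n → EuclideanSpace ℝ (Fin d)
  y : ℝ → Fin k → EuclideanSpace ℝ (Fin d)
  u : Fin k → (Fin k → EuclideanSpace ℝ (Fin d)) → ℝ → EuclideanSpace ℝ (Fin d)
  w : Fin n → ℝ → EuclideanSpace ℝ (Fin d)
  u_cont : ∀ j t, Continuous fun yv => u j yv t
  w_cont : ∀ i, Continuous (w i)
  x_cont : ∀ i, Continuous fun t => x t i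
  y_cont : ∀ j, Continuous fun t => y t j
  dyn_y : ∀ (j : Fin k), ∀ t ≥ (0:ℝ),
    HasDerivWithinAt (fun s => y s j) (u j (y t) t) (Set.Ici t) t
  dyn_x : ∀ (i : Fin n), ∀ t ≥ (0:ℝ),
    HasDerivWithinAt (fun s => x s i)
      ((∑ j ∈ D.Nb t i, D.A i j (x t) (y t) t • (x t j - x t i)) +
        (∑ j ∈ D.Ld t i, D.B i j (x t) (y t) t • (y t j - x t i)) + w i t)
      (Set.Ici t) t
  r_int : ∀ a b : ℝ, IntervalIntegrable (fun t => ⨆ j : Fin k, ‖u j (y t) t‖)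
    MeasureTheory.volume a b
  q_int : ∀ a b : ℝ, IntervalIntegrable
    (fun t => (⨆ j : Fin k, ‖u j (y t) t‖) + ⨆ i : Fin n, ‖w i t‖)
    MeasureTheory.volume a b
  z_int : ∀ a b : ℝ, IntervalIntegrable
    (fun t => Real.sqrt ((∑ j : Fin k, ‖u j (y t) t‖ ^ 2) + ∑ i : Fin n, ‖w i t‖ ^ 2))
    MeasureTheory.volume a b

namespace MASSol

variable {d n k : ℕ} {D : MASData d n k}

/-- The moving multi-leader set `ℒ(y(t))`: the convex hull of the leaders. -/
def Lset (sol : MASSol D) (t : ℝ) : Set (EuclideanSpace ℝ (Fin d)) :=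
  convexHull ℝ (Set.range (sol.y t))

/-- `|x(t)|_{ℒ(y(t))}`: the maximal distance of the followers from `ℒ(y(t))`. -/
def distL (sol : MASSol D) (t : ℝ) : ℝ :=
  ⨆ i : Fin n, Metric.infDist (sol.x t i) (sol.Lset t)

/-- `r(t) = max_j |u_j(y(t),t)|`. -/
def rmax (sol : MASSol D) (t : ℝ) : ℝ := ⨆ j : Fin k, ‖sol.u j (sol.y t) t‖

/-- `q(t) = max_j |u_j(y(t),t)| + max_i |w_i(t)|`. -/
def qmax (sol : MASSol D) (t : ℝ) : ℝ := sol.rmax t + ⨆ i : Fin n, ‖sol.w i t‖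

/-- `|z(t)|`: the Euclidean norm of the combined input `z = (u, w)` at time `t`. -/
def znorm (sol : MASSol D) (t : ℝ) : ℝ :=
  Real.sqrt ((∑ j : Fin k, ‖sol.u j (sol.y t) t‖ ^ 2) + ∑ i : Fin n, ‖sol.w i t‖ ^ 2)

/-- `‖z‖_∞ = sup_{t ≥ 0} |z(t)|`. -/
def zsup (sol : MASSol D) : ℝ := sSup (sol.znorm '' Set.Ici 0)

/-- The combined input `z` is (essentially) bounded, i.e. `z ∈ L_∞`. -/
def zBounded (sol : MASSol D) : Prop := BddAbove (sol.znorm '' Set.Ici 0)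

end MASSol

/-- Class-𝒦 function on `[0,∞)`. -/
def IsClassK (γ : ℝ → ℝ) : Prop :=
  ContinuousOn γ (Set.Ici 0) ∧ StrictMonoOn γ (Set.Ici 0) ∧ γ 0 = 0

/-- Class-𝒦𝓛 function. -/
def IsClassKL (β : ℝ → ℝ → ℝ) : Prop :=
  (∀ t ≥ (0:ℝ), IsClassK fun s => β s t) ∧
  (∀ s ≥ (0:ℝ), AntitoneOn (fun t => β s t) (Set.Ici 0) ∧
    Filter.Tendsto (fun t => β s t) Filter.atTop (nhds 0))

/-- System (5) is (generalized) set input-to-state stable with respect to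
`ℒ(y(t))` with input `z`. -/
def MASData.SISS {d n k : ℕ} (D : MASData d n k) : Prop :=
  ∃ β γ, IsClassKL β ∧ IsClassK γ ∧
    ∀ sol : MASSol D, sol.zBounded →
      ∀ t ≥ (0:ℝ), sol.distL t ≤ β (sol.distL 0) t + γ sol.zsup

/-- System (5) is (generalized) set integral-input-to-state stable with respect
to `ℒ(y(t))`. -/
def MASData.SiISS {d n k : ℕ} (D : MASData d n k) : Prop :=
  ∃ β γ, IsClassKL β ∧ IsClassK γ ∧
    ∀ sol : MASSol D, ∀ t ≥ (0:ℝ),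
      sol.distL t ≤ β (sol.distL 0) t + ∫ s in (0:ℝ)..t, γ (sol.znorm s)

/-- The upper Dini derivative `D⁺h(t) = limsup_{s→0⁺} (h(t+s) − h(t))/s`. -/
def upperDini (h : ℝ → ℝ) (t : ℝ) : ℝ :=
  Filter.limsup (fun s => (h (t + s) - h t) / s) (nhdsWithin 0 (Set.Ioi 0))

/-- A comparison principle for a finite family of functions with right derivatives: a family that
starts nonpositive stays so if a component that vanishes has negative right derivative as long as
no component is positive. -/
theorem forall_nonpos_of_deriv_right_neg {ι : Type*} [Finite ι] {g g' : ι → ℝ → ℝ} {a b : ℝ}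
    (hc : ∀ i, Continuous (g i))
    (hd : ∀ i, ∀ t ∈ Ico a b, HasDerivWithinAt (g i) (g' i t) (Ici t) t)
    (ha : ∀ i, g i a ≤ 0)
    (hneg : ∀ t ∈ Ico a b, (∀ j, g j t ≤ 0) → ∀ i, g i t = 0 → g' i t < 0) :
    ∀ t ∈ Icc a b, ∀ i, g i t ≤ 0 := by
  have hcl : IsClosed {t | ∀ i, g i t ≤ 0} := by
    simp only [ofPred_forall]
    exact isClosed_iInter fun i => isClosed_le (hc i) continuous_const
  refine (hcl.inter isClosed_Icc).Icc_subset_of_forall_mem_nhdsWithin ha ?_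
  rintro t ⟨ht, htab⟩
  refine eventually_all.2 fun i => ?_
  rcases (ht i).lt_or_eq with hlt | heq
  · exact (((hc i).continuousAt.eventually_lt continuousAt_const hlt).filter_mono
      nhdsWithin_le_nhds).mono fun _ h => h.le
  · have hs := (hd i t htab).Ioi_of_Ici.limsup_slope_le' (lt_irrefl t) (hneg t htab ht i heq)
    filter_upwards [hs, self_mem_nhdsWithin] with z hz htz
    rw [slope_def_field, heq, sub_zero] at hz
    have hpos : 0 < z - t := sub_pos.2 htz
    by_contra! hcon
    exact absurd hz (not_lt.2 (div_nonneg hcon.le hpos.le))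

theorem exists_rel_of_reflTransGen {α : Type*} {r : α → α → Prop} {p : α → Prop} {a b : α}
    (h : Relation.ReflTransGen r a b) (ha : p a) (hb : ¬ p b) :
    ∃ x y, p x ∧ r x y ∧ ¬ p y := by
  induction h with
  | refl => exact absurd ha hb
  | @tail c d _ hcd ih =>
    by_cases hc : p c
    · exact ⟨c, d, hc, hcd, hb⟩
    · exact ih hc

theorem inner_le_add_infDist_convexHull {E ι : Type*} [NormedAddCommGroup E]
    [InnerProductSpace ℝ E] [Finite ι] [Nonempty ι] {y : ι → E} {v : E} (hv : ‖v‖ ≤ 1) {S : ℝ}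
    (hS : ∀ j, inner ℝ v (y j) ≤ S) (x : E) :
    inner ℝ v x ≤ S + infDist x (convexHull ℝ (range y)) := by
  have hne : (convexHull ℝ (range y)).Nonempty := (range_nonempty y).convexHull
  obtain ⟨p, hp, hxp⟩ :=
    (finite_range y).isCompact_convexHull (𝕜 := ℝ) |>.exists_infDist_eq_dist hne x
  have hpS : inner ℝ v p ≤ S := by
    have hsub : convexHull ℝ (range y) ⊆ {q | inner ℝ v q ≤ S} :=
      convexHull_min (range_subset_iff.2 hS)
        (convex_halfSpace_le (innerSL ℝ v).toLinearMap.isLinear S)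
    exact hsub hp
  have hle : inner ℝ v (x - p) ≤ dist x p := by
    rw [dist_eq_norm]
    exact (real_inner_le_norm _ _).trans (mul_le_of_le_one_left (norm_nonneg _) hv)
  rw [inner_sub_right] at hle
  linarith

theorem infDist_convexHull_le_of_forall_inner {E ι : Type*} [NormedAddCommGroup E]
    [InnerProductSpace ℝ E] [Finite ι] [Nonempty ι] {y : ι → E} {x : E} {C : ℝ} (hC : 0 ≤ C)
    (h : ∀ v : E, ‖v‖ = 1 → ∃ j, inner ℝ v x ≤ inner ℝ v (y j) + C) :
    infDist x (convexHull ℝ (range y)) ≤ C := by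
  have hne : (convexHull ℝ (range y)).Nonempty := (range_nonempty y).convexHull
  have hcomp := (finite_range y).isCompact_convexHull (𝕜 := ℝ)
  obtain ⟨p, hp, hxp⟩ := exists_norm_eq_iInf_of_complete_convex hne hcomp.isComplete
    (convex_convexHull ℝ _) x
  have hproj := (norm_eq_iInf_iff_real_inner_le_zero (convex_convexHull ℝ _) hp).1 hxp
  refine (infDist_le_dist_of_mem hp).trans ?_
  rw [dist_eq_norm]
  rcases eq_or_ne (x - p) 0 with h0 | h0
  · simpa [h0] using hC
  have hpos : 0 < ‖x - p‖ := norm_pos_iff.2 h0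
  obtain ⟨j, hj⟩ := h (‖x - p‖⁻¹ • (x - p)) (norm_smul_inv_norm h0)
  have hy := hproj (y j) (subset_convexHull ℝ _ (mem_range_self j))
  have hmul : inner ℝ (x - p) x ≤ inner ℝ (x - p) (y j) + ‖x - p‖ * C := by
    have := mul_le_mul_of_nonneg_left hj hpos.le
    simpa [real_inner_smul_left, mul_add, hpos.ne'] using this
  have hsq : inner ℝ (x - p) (x - p) = ‖x - p‖ * ‖x - p‖ := real_inner_self_eq_norm_mul_norm _
  rw [inner_sub_right] at hsq hy
  exact le_of_mul_le_mul_left (by linarith) hpos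

/-- Scalar functions attached to the followers which relax towards their common upper bounds at
rate at most `κ` and are pulled at rate at least `α` towards the value of each in-neighbor, leaders
having value `0`. -/
structure ScalarFlow {d n k : ℕ} (D : MASData d n k) (κ α t₀ t₁ : ℝ) (f f' : Fin n → ℝ → ℝ) :
    Prop where
  cont : ∀ i, Continuous (f i)
  deriv : ∀ i, ∀ t ∈ Ico t₀ t₁, HasDerivWithinAt (f i) (f' i t) (Ici t) t
  decay : ∀ i, ∀ t ∈ Ico t₀ t₁, ∀ H, (∀ j, f j t ≤ H) → 0 ≤ f i t → f' i t ≤ κ * (H - f i t)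
  drive : ∀ v i, ∀ t ∈ Ico t₀ t₁, D.arcAt t v (Sum.inr i) →
    ∀ H, (∀ j, f j t ≤ H) → 0 ≤ f i t →
      f' i t ≤ κ * (H - f i t) - α * (H - Sum.elim (fun _ => 0) (fun j => f j t) v)

namespace ScalarFlow

variable {d n k : ℕ} {D : MASData d n k} {κ α t₀ t₁ H : ℝ} {f f' : Fin n → ℝ → ℝ}

theorem le_of_initial_le (hf : ScalarFlow D κ α t₀ t₁ f f') (hH : 0 ≤ H)
    (h0 : ∀ i, f i t₀ ≤ H) : ∀ t ∈ Icc t₀ t₁, ∀ i, f i t ≤ H := by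
  have key : ∀ ε > 0, ∀ t ∈ Icc t₀ t₁, ∀ i, f i t - (H + ε * (t - t₀)) ≤ 0 := by
    intro ε hε
    refine forall_nonpos_of_deriv_right_neg (g := fun i t => f i t - (H + ε * (t - t₀)))
      (g' := fun i t => f' i t - ε) (fun i => ?_) (fun i t ht => ?_) (fun i => ?_) ?_
    · exact (hf.cont i).sub (by fun_prop)
    · refine (hf.deriv i t ht).sub ?_
      simpa using ((((hasDerivAt_id t).sub_const t₀).const_mul ε).const_add H).hasDerivWithinAt
    · simpa using h0 i
    · intro t ht hle i hi
      have hb : 0 ≤ ε * (t - t₀) := mul_nonneg hε.le (sub_nonneg.2 ht.1)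
      have := hf.decay i t ht (H + ε * (t - t₀)) (fun j => by linarith [hle j]) (by linarith)
      rw [show H + ε * (t - t₀) - f i t = 0 by linarith, mul_zero] at this
      linarith
  intro t ht i
  refine le_of_forall_pos_le_add fun ε hε => ?_
  have hpos : 0 < t - t₀ + 1 := by linarith [ht.1]
  have h1 := key (ε / (t - t₀ + 1)) (div_pos hε hpos) t ht i
  have h2 : ε / (t - t₀ + 1) * (t - t₀) ≤ ε := by
    rw [div_mul_eq_mul_div, div_le_iff₀ hpos]
    nlinarith
  linarith

theorem le_exp_of_le (hf : ScalarFlow D κ α t₀ t₁ f f') (hκ : 0 ≤ κ) (hH : 0 < H)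
    (hle : ∀ t ∈ Icc t₀ t₁, ∀ i, f i t ≤ H) {s η : ℝ} (hs : t₀ ≤ s) (hη : 0 < η) (hη1 : η ≤ 1)
    {i : Fin n} (hi : f i s ≤ (1 - η) * H) :
    ∀ t ∈ Icc s t₁, f i t ≤ (1 - η * Real.exp (-(κ + 1) * (t - s))) * H := by
  refine image_le_of_deriv_right_lt_deriv_boundary'
    (f' := f' i) (B' := fun t => η * (κ + 1) * Real.exp (-(κ + 1) * (t - s)) * H)
    (hf.cont i).continuousOn (fun t ht => hf.deriv i t ⟨hs.trans ht.1, ht.2⟩) (by simpa using hi)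
    (by fun_prop) (fun t _ => ?_) ?_
  · have h := ((((((hasDerivAt_id t).sub_const s).const_mul (-(κ + 1))).exp.const_mul η).const_sub
      1).mul_const H).hasDerivWithinAt (s := Ici t)
    refine h.congr_deriv ?_
    simp only [id]
    ring
  · intro t ht heq
    set e := Real.exp (-(κ + 1) * (t - s))
    have he : 0 < e := Real.exp_pos _
    have he1 : e ≤ 1 := Real.exp_le_one_iff.2 (by nlinarith [ht.1])
    have ht' : t ∈ Ico t₀ t₁ := ⟨hs.trans ht.1, ht.2⟩
    have h0 : 0 ≤ f i t := by
      rw [heq]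
      exact mul_nonneg (by nlinarith) hH.le
    have h1 := hf.decay i t ht' H (hle t (Ico_subset_Icc_self ht')) h0
    have h2 : 0 < η * e * H := by positivity
    have h3 : κ * (H - f i t) = κ * (η * e * H) := by rw [heq]; ring
    have h4 : η * (κ + 1) * e * H = κ * (η * e * H) + η * e * H := by ring
    linarith

theorem le_of_arcAt (hf : ScalarFlow D κ α t₀ t₁ f f') (hα : 0 < α) (hακ : α ≤ κ) (hH : 0 < H)
    (hle : ∀ t ∈ Icc t₀ t₁, ∀ i, f i t ≤ H) {s τ θ : ℝ} (hs : t₀ ≤ s) (hτ : 0 < τ)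
    (hsτ : s + τ ≤ t₁) (hθ : 0 < θ) (hθ1 : θ ≤ 1) {v : Fin k ⊕ Fin n} {i : Fin n}
    (harc : ∀ t ∈ Ico s (s + τ), D.arcAt t v (Sum.inr i))
    (hv : ∀ t ∈ Ico s (s + τ), Sum.elim (fun _ => 0) (fun j => f j t) v ≤ (1 - θ) * H) :
    f i (s + τ) ≤ (1 - α / (2 * (1 + κ * τ)) * τ * θ) * H := by
  have hκ : 0 < κ := hα.trans_le hακ
  have hκτ : 0 < κ * τ := mul_pos hκ hτ
  set c := α / (2 * (1 + κ * τ)) with hc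
  have hc0 : 0 < c := by positivity
  have hcα : c * (2 * (1 + κ * τ)) = α := div_mul_cancel₀ _ (by positivity)
  have hcτ : c * τ ≤ 1 := by
    rw [hc, div_mul_eq_mul_div, div_le_one (by positivity)]
    nlinarith
  have key : ∀ t ∈ Icc s (s + τ), f i t ≤ (1 - c * θ * (t - s)) * H := by
    refine image_le_of_deriv_right_lt_deriv_boundary' (f' := f' i) (B' := fun _ => -(c * θ) * H)
      (hf.cont i).continuousOn
      (fun t ht => hf.deriv i t ⟨hs.trans ht.1, ht.2.trans_le hsτ⟩) ?_ (by fun_prop)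
      (fun t _ => ?_) ?_
    · simpa using hle s ⟨hs, by linarith⟩ i
    · have h := (((((hasDerivAt_id t).sub_const s).const_mul (c * θ)).const_sub
        1).mul_const H).hasDerivWithinAt (s := Ici t)
      exact h.congr_deriv (by ring)
    · intro t ht heq
      have ht' : t ∈ Ico t₀ t₁ := ⟨hs.trans ht.1, ht.2.trans_le hsτ⟩
      have hts : 0 ≤ t - s := sub_nonneg.2 ht.1
      have htτ : t - s ≤ τ := by linarith [ht.2]
      have hη : c * θ * (t - s) ≤ c * θ * τ := mul_le_mul_of_nonneg_left htτ (by positivity)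
      have hη1 : c * θ * τ ≤ 1 := by nlinarith
      have h0 : 0 ≤ f i t := by
        rw [heq]
        exact mul_nonneg (by linarith) hH.le
      have h1 := hf.drive v i t ht' (harc t ht) H (hle t (Ico_subset_Icc_self ht')) h0
      have h2 : α * (θ * H) ≤ α * (H - Sum.elim (fun _ => 0) (fun j => f j t) v) :=
        mul_le_mul_of_nonneg_left (by linarith [hv t ht]) hα.le
      have h3 : κ * (H - f i t) = κ * (c * θ * (t - s)) * H := by rw [heq]; ring
      have h4 : κ * (c * θ * (t - s)) * H ≤ κ * (c * θ * τ) * H := by gcongr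
      have h5 : α * (θ * H) = 2 * (c * θ * H) + 2 * (κ * (c * θ * τ) * H) := by
        rw [← hcα]; ring
      have h6 : 0 < c * θ * H := by positivity
      have h7 : 0 < κ * (c * θ * τ) * H := by positivity
      linarith
  have := key (s + τ) ⟨by linarith, le_rfl⟩
  rw [add_sub_cancel_left] at this
  linarith [this, show c * θ * τ * H = c * τ * θ * H by ring]

end ScalarFlow

namespace MASData

variable {d n k : ℕ} (D : MASData d n k)

/-- An arc present at some time stays present for a whole dwell time around it. -/
theorem exists_arcAt_of_dwell {s t : ℝ} (hs : 0 ≤ s) (ht : s + D.τD ≤ t) {v v' : Fin k ⊕ Fin n}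
    (h : D.arcAt t v v') :
    ∃ a, s ≤ a ∧ a ≤ t ∧ ∀ r ∈ Ico a (a + D.τD), D.arcAt r v v' := by
  obtain ⟨σ, hσ0, hσ, hconst⟩ := D.dwell
  have hτ := D.τD_pos
  have hgrow : ∀ m : ℕ, m * D.τD ≤ σ m := by
    intro m
    induction m with
    | zero => simp [hσ0]
    | succ m ih =>
      push_cast
      linarith [hσ m]
  have hex : ∃ m, t < σ m := by
    obtain ⟨m, hm⟩ := exists_nat_gt (t / D.τD)
    exact ⟨m, ((div_lt_iff₀ hτ).1 hm).trans_le (hgrow m)⟩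
  classical
  obtain ⟨m, hm1, hm2⟩ : ∃ m, σ m ≤ t ∧ t < σ (m + 1) := by
    have hfind := Nat.find_spec hex
    have hne : Nat.find hex ≠ 0 := fun h0 => by
      rw [h0, hσ0] at hfind
      linarith
    obtain ⟨m, hm⟩ := Nat.exists_eq_succ_of_ne_zero hne
    exact ⟨m, not_lt.1 (Nat.find_min hex (by omega)), by rw [hm] at hfind; exact hfind⟩
  refine ⟨max (σ m) (t - D.τD), le_max_of_le_right (by linarith), max_le hm1 (by linarith), ?_⟩
  intro r hr
  have hr1 : σ m ≤ r := (le_max_left _ _).trans hr.1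
  have hr2 : r < σ (m + 1) := by
    rcases max_cases (σ m) (t - D.τD) with ⟨h1, -⟩ | ⟨h1, -⟩ <;> have := hr.2 <;> rw [h1] at this
    · linarith [hσ m]
    · linarith
  obtain ⟨hN, hL⟩ := hconst m r ⟨hr1, hr2⟩ t ⟨hm1, hm2⟩
  unfold arcAt at h ⊢
  rwa [hN, hL]

end MASData

namespace ScalarFlow

variable {d n k : ℕ} {D : MASData d n k} {κ α t₀ t₁ H : ℝ} {f f' : Fin n → ℝ → ℝ}

/-- The factor by which the guaranteed decrease shrinks over one period of joint connectivity. -/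
def stageFactor (κ α τ T : ℝ) : ℝ :=
  α / (2 * (1 + κ * τ)) * τ * Real.exp (-(κ + 1) * T) ^ 2

theorem stageFactor_pos {τ T : ℝ} (hα : 0 < α) (hκ : 0 < κ) (hτ : 0 < τ) :
    0 < stageFactor κ α τ T := by
  unfold stageFactor
  positivity

theorem stageFactor_le_exp {τ T : ℝ} (hα : 0 < α) (hακ : α ≤ κ) (hτ : 0 < τ) (hT : 0 ≤ T) :
    stageFactor κ α τ T ≤ Real.exp (-(κ + 1) * T) := by
  have hκ : 0 < κ := hα.trans_le hακ
  have he : 0 < Real.exp (-(κ + 1) * T) := Real.exp_pos _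
  have he1 : Real.exp (-(κ + 1) * T) ≤ 1 := Real.exp_le_one_iff.2 (by nlinarith)
  have hc : α / (2 * (1 + κ * τ)) * τ ≤ 1 := by
    rw [div_mul_eq_mul_div, div_le_one (by positivity)]
    nlinarith [mul_pos hκ hτ]
  have hc0 : 0 < α / (2 * (1 + κ * τ)) * τ := by positivity
  unfold stageFactor
  nlinarith [mul_le_mul hc he1 he.le zero_le_one]

theorem exists_larger_finset (hf : ScalarFlow D κ α t₀ t₁ f f') (hα : 0 < α) (hακ : α ≤ κ)
    (hH : 0 < H) (hle : ∀ t ∈ Icc t₀ t₁, ∀ i, f i t ≤ H) {T s θ : ℝ} (hT : 0 < T)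
    (hconn : ∀ t ≥ 0, D.LConnectedOn (Ico t (t + T))) (h0 : 0 ≤ t₀) (hs : t₀ ≤ s)
    (hsT : s + (T + 2 * D.τD) ≤ t₁) (hθ : 0 < θ) (hθ1 : θ ≤ 1) {R : Finset (Fin n)}
    (hR : ∀ i ∈ R, f i s ≤ (1 - θ) * H) :
    ∃ R' : Finset (Fin n), min (R.card + 1) n ≤ R'.card ∧ ∀ i ∈ R',
      f i (s + (T + 2 * D.τD)) ≤ (1 - stageFactor κ α D.τD (T + 2 * D.τD) * θ) * H := by
  have hτ := D.τD_pos
  have hκ : 0 < κ := hα.trans_le hακ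
  set L := T + 2 * D.τD with hL
  set e := Real.exp (-(κ + 1) * L) with he_def
  have he : 0 < e := Real.exp_pos _
  have he1 : e ≤ 1 := Real.exp_le_one_iff.2 (by nlinarith)
  have hρ := stageFactor_le_exp (T := L) hα hακ hτ (by linarith)
  have hexp : ∀ r ≤ L, e ≤ Real.exp (-(κ + 1) * r) := fun r hr =>
    Real.exp_le_exp.2 (by nlinarith)
  have hold : ∀ i ∈ R, ∀ t ∈ Icc s (s + L), f i t ≤ (1 - θ * e) * H := by
    intro i hi t ht
    refine (hf.le_exp_of_le hκ.le hH hle hs hθ hθ1 (hR i hi) t ⟨ht.1, ht.2.trans hsT⟩).trans ?_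
    have := hexp (t - s) (by linarith [ht.2])
    gcongr
  have hend : ∀ i ∈ R, f i (s + L) ≤ (1 - stageFactor κ α D.τD L * θ) * H := by
    intro i hi
    refine (hold i hi (s + L) ⟨by linarith, le_rfl⟩).trans ?_
    rw [mul_comm θ e]
    gcongr
  by_cases huniv : ∀ i, i ∈ R
  · exact ⟨R, by simp [Finset.eq_univ_iff_forall.2 huniv], hend⟩
  push Not at huniv
  obtain ⟨i₀, hi₀⟩ := huniv
  obtain ⟨j, hpath⟩ := hconn (s + D.τD) (by linarith) i₀
  obtain ⟨v, v', hv, ⟨t, ht, harc⟩, hv'⟩ := exists_rel_of_reflTransGen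
    (p := fun v => ∀ i, v = Sum.inr i → i ∈ R) hpath (by simp) (by simpa using hi₀)
  push Not at hv'
  obtain ⟨i, rfl, hi⟩ := hv'
  obtain ⟨a, hsa, hat, ha⟩ := D.exists_arcAt_of_dwell (h0.trans hs) ht.1 harc
  have haL : a + D.τD ≤ s + L := by linarith [ht.2]
  have hval : ∀ r ∈ Ico a (a + D.τD),
      Sum.elim (fun _ => 0) (fun j => f j r) v ≤ (1 - θ * e) * H := by
    intro r hr
    rcases v with j | j
    · exact mul_nonneg (by nlinarith) hH.le
    · exact hold j (hv j rfl) r ⟨hsa.trans hr.1, hr.2.le.trans haL⟩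
  have hθe : 0 < θ * e := mul_pos hθ he
  have hθe1 : θ * e ≤ 1 := by nlinarith
  have hnew := hf.le_of_arcAt hα hακ hH hle (hs.trans hsa) hτ (haL.trans hsT) hθe hθe1 ha hval
  have hγ : 0 < α / (2 * (1 + κ * D.τD)) * D.τD := by positivity
  have hγ1 : α / (2 * (1 + κ * D.τD)) * D.τD ≤ 1 := by
    rw [div_mul_eq_mul_div, div_le_one (by positivity)]
    nlinarith [mul_pos hκ hτ]
  have hnewend := hf.le_exp_of_le hκ.le hH hle (by linarith : t₀ ≤ a + D.τD) (mul_pos hγ hθe)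
    (by nlinarith) hnew (s + L) ⟨haL, hsT⟩
  refine ⟨insert i R, by simp [Finset.card_insert_of_notMem hi], fun l hl => ?_⟩
  rcases Finset.mem_insert.1 hl with rfl | hl
  · refine hnewend.trans ?_
    have h1 := hexp (s + L - (a + D.τD)) (by linarith)
    have h2 : stageFactor κ α D.τD L * θ
        = α / (2 * (1 + κ * D.τD)) * D.τD * (θ * e) * e := by
      rw [stageFactor]; ring
    rw [h2]
    gcongr
  · exact hend l hl

theorem le_contraction (hf : ScalarFlow D κ α t₀ t₁ f f') (hα : 0 < α) (hακ : α ≤ κ)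
    (hH : 0 < H) (hinit : ∀ i, f i t₀ ≤ H) {T : ℝ} (hT : 0 < T)
    (hconn : ∀ t ≥ 0, D.LConnectedOn (Ico t (t + T))) (h0 : 0 ≤ t₀)
    (ht₁ : t₁ = t₀ + n * (T + 2 * D.τD)) (i : Fin n) :
    f i t₁ ≤ (1 - stageFactor κ α D.τD (T + 2 * D.τD) ^ n) * H := by
  have hτ := D.τD_pos
  have hκ : 0 < κ := hα.trans_le hακ
  have hL : 0 < T + 2 * D.τD := by linarith
  have hle : ∀ t ∈ Icc t₀ t₁, ∀ i, f i t ≤ H := hf.le_of_initial_le hH.le hinit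
  have hρ0 : 0 < stageFactor κ α D.τD (T + 2 * D.τD) := stageFactor_pos hα hκ hτ
  have hρ1 : stageFactor κ α D.τD (T + 2 * D.τD) ≤ 1 :=
    (stageFactor_le_exp hα hακ hτ hL.le).trans (Real.exp_le_one_iff.2 (by nlinarith))
  have key : ∀ m ≤ n, ∃ R : Finset (Fin n), m ≤ R.card ∧ ∀ i ∈ R,
      f i (t₀ + m * (T + 2 * D.τD)) ≤ (1 - stageFactor κ α D.τD (T + 2 * D.τD) ^ m) * H := by
    intro m
    induction m with
    | zero => exact fun _ => ⟨∅, by simp⟩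
    | succ m ih =>
      intro hm
      obtain ⟨R, hcard, hR⟩ := ih (by omega)
      have hmn : ((m : ℝ) + 1) * (T + 2 * D.τD) ≤ n * (T + 2 * D.τD) := by
        gcongr
        exact_mod_cast hm
      have hm0 : 0 ≤ (m : ℝ) * (T + 2 * D.τD) := by positivity
      obtain ⟨R', hcard', hR'⟩ := hf.exists_larger_finset hα hακ hH hle hT hconn h0
        (by linarith) (by linarith) (pow_pos hρ0 m) (pow_le_one₀ hρ0.le hρ1) hR
      refine ⟨R', by omega, fun i hi => ?_⟩
      have := hR' i hi
      rw [pow_succ']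
      convert this using 2
      push_cast
      ring
  obtain ⟨R, hcard, hR⟩ := key n le_rfl
  have huniv : R = Finset.univ := Finset.card_eq_iff_eq_univ R |>.1
    (le_antisymm (Finset.card_le_univ R) (by simpa using hcard))
  rw [ht₁]
  exact hR i (huniv ▸ Finset.mem_univ i)

end ScalarFlow

namespace MASData

variable {d n k : ℕ} (D : MASData d n k)

/-- A lower bound for all the weights. -/
def pullRate : ℝ := min D.aLo D.bLo

/-- An upper bound for the rate at which a follower is pushed towards the farthest follower. -/
def pushRate : ℝ := n * D.aHi + D.pullRate

theorem pullRate_pos : 0 < D.pullRate := lt_min D.aLo_pos D.bLo_pos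

theorem aHi_pos : 0 < D.aHi := by
  have i : Fin n := ⟨0, by have := D.hn; omega⟩
  exact D.aLo_pos.trans_le ((D.A_bdd i i 0 0 0).1.trans (D.A_bdd i i 0 0 0).2)

theorem pullRate_le_pushRate : D.pullRate ≤ D.pushRate :=
  le_add_of_nonneg_left (mul_nonneg (Nat.cast_nonneg n) D.aHi_pos.le)

theorem sum_weight_mul_le {xv yv} {t r : ℝ} (hr : 0 ≤ r) (i : Fin n) (N : Finset (Fin n)) :
    ∑ j ∈ N, D.A i j xv yv t * r ≤ n * D.aHi * r := by
  refine (Finset.sum_le_card_nsmul N _ (D.aHi * r) fun j _ =>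
    mul_le_mul_of_nonneg_right (D.A_bdd i j xv yv t).2 hr).trans ?_
  rw [nsmul_eq_mul, mul_assoc]
  refine mul_le_mul_of_nonneg_right ?_ (mul_nonneg D.aHi_pos.le hr)
  exact_mod_cast (Finset.card_le_univ N).trans_eq (Fintype.card_fin n)

theorem sum_followers_le {xv yv} {t H : ℝ} {f : Fin n → ℝ} {i : Fin n} (hH : ∀ j, f j ≤ H)
    (N : Finset (Fin n)) :
    ∑ j ∈ N, D.A i j xv yv t * (f j - f i) ≤ n * D.aHi * (H - f i) :=
  (Finset.sum_le_sum fun j _ => mul_le_mul_of_nonneg_left (sub_le_sub_right (hH j) (f i))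
    (D.aLo_pos.trans_le (D.A_bdd i j xv yv t).1).le).trans
      (D.sum_weight_mul_le (sub_nonneg.2 (hH i)) i N)

theorem sum_followers_le_of_mem {xv yv} {t H : ℝ} {f : Fin n → ℝ} {i j₀ : Fin n}
    (hH : ∀ j, f j ≤ H) {N : Finset (Fin n)} (hj₀ : j₀ ∈ N) :
    ∑ j ∈ N, D.A i j xv yv t * (f j - f i) ≤ n * D.aHi * (H - f i) - D.aLo * (H - f j₀) := by
  have hsplit : ∑ j ∈ N, D.A i j xv yv t * (f j - f i)
      = ∑ j ∈ N, D.A i j xv yv t * (H - f i) - ∑ j ∈ N, D.A i j xv yv t * (H - f j) := by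
    rw [← Finset.sum_sub_distrib]
    exact Finset.sum_congr rfl fun j _ => by ring
  have h1 := D.sum_weight_mul_le (xv := xv) (yv := yv) (t := t) (sub_nonneg.2 (hH i)) i N
  have h2 : D.aLo * (H - f j₀) ≤ ∑ j ∈ N, D.A i j xv yv t * (H - f j) :=
    (mul_le_mul_of_nonneg_right (D.A_bdd i j₀ xv yv t).1 (sub_nonneg.2 (hH j₀))).trans
      (Finset.single_le_sum (f := fun j => D.A i j xv yv t * (H - f j))
        (fun j _ => mul_nonneg (D.aLo_pos.trans_le (D.A_bdd i j xv yv t).1).le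
          (sub_nonneg.2 (hH j))) hj₀)
  linarith

end MASData

namespace MASSol

variable {d n k : ℕ} {D : MASData d n k} (sol : MASSol D)

theorem znorm_nonneg (t : ℝ) : 0 ≤ sol.znorm t := Real.sqrt_nonneg _

theorem norm_u_le_znorm (j : Fin k) (t : ℝ) : ‖sol.u j (sol.y t) t‖ ≤ sol.znorm t := by
  refine Real.le_sqrt_of_sq_le ?_
  have h1 := Finset.single_le_sum (f := fun j => ‖sol.u j (sol.y t) t‖ ^ 2)
    (fun j _ => sq_nonneg _) (Finset.mem_univ j)
  have h2 : 0 ≤ ∑ i : Fin n, ‖sol.w i t‖ ^ 2 := Finset.sum_nonneg fun i _ => sq_nonneg _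
  linarith

/-- The Euclidean norm of the combined disturbance. -/
def wnorm (t : ℝ) : ℝ := Real.sqrt (∑ i : Fin n, ‖sol.w i t‖ ^ 2)

theorem continuous_wnorm : Continuous sol.wnorm :=
  Real.continuous_sqrt.comp (continuous_finsetSum _ fun i _ => (sol.w_cont i).norm.pow 2)

theorem wnorm_nonneg (t : ℝ) : 0 ≤ sol.wnorm t := Real.sqrt_nonneg _

theorem norm_w_le_wnorm (i : Fin n) (t : ℝ) : ‖sol.w i t‖ ≤ sol.wnorm t :=
  Real.le_sqrt_of_sq_le (Finset.single_le_sum (f := fun i => ‖sol.w i t‖ ^ 2)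
    (fun _ _ => sq_nonneg _) (Finset.mem_univ i))

theorem wnorm_le_znorm (t : ℝ) : sol.wnorm t ≤ sol.znorm t :=
  Real.sqrt_le_sqrt (le_add_of_nonneg_left (Finset.sum_nonneg fun _ _ => sq_nonneg _))

theorem intervalIntegrable_znorm (a b : ℝ) : IntervalIntegrable sol.znorm volume a b :=
  sol.z_int a b

theorem inner_y_sub_le {v : EuclideanSpace ℝ (Fin d)} (hv : ‖v‖ ≤ 1) {a b : ℝ} (ha : 0 ≤ a)
    (hab : a ≤ b) (j : Fin k) :
    inner ℝ v (sol.y b j) - inner ℝ v (sol.y a j) ≤ ∫ t in a..b, sol.znorm t := by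
  refine intervalIntegral.sub_le_integral_of_hasDeriv_right_of_le
    (g := fun t => inner ℝ v (sol.y t j)) (g' := fun t => inner ℝ v (sol.u j (sol.y t) t)) hab
    ((continuous_const.inner (sol.y_cont j)).continuousOn) (fun t ht => ?_)
    ((intervalIntegrable_iff_integrableOn_Icc_of_le hab).1 (sol.intervalIntegrable_znorm a b))
    (fun t _ => ?_)
  · exact (innerSL ℝ v).hasFDerivAt.comp_hasDerivWithinAt t
      ((sol.dyn_y j t (ha.trans ht.1.le)).Ioi_of_Ici)
  · exact ((real_inner_le_norm _ _).trans (mul_le_of_le_one_left (norm_nonneg _) hv)).trans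
      (sol.norm_u_le_znorm j t)

theorem integral_znorm_nonneg {a b : ℝ} (hab : a ≤ b) : 0 ≤ ∫ t in a..b, sol.znorm t :=
  intervalIntegral.integral_nonneg hab fun t _ => sol.znorm_nonneg t

theorem integral_wnorm_nonneg {a b : ℝ} (hab : a ≤ b) : 0 ≤ ∫ t in a..b, sol.wnorm t :=
  intervalIntegral.integral_nonneg hab fun t _ => sol.wnorm_nonneg t

theorem integral_wnorm_le {a b : ℝ} (hab : a ≤ b) :
    ∫ t in a..b, sol.wnorm t ≤ ∫ t in a..b, sol.znorm t :=
  intervalIntegral.integral_mono_on hab (sol.continuous_wnorm.intervalIntegrable a b)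
    (sol.intervalIntegrable_znorm a b) fun t _ => sol.wnorm_le_znorm t

/-- The right-hand side of the dynamics of follower `i`. -/
def xVel (i : Fin n) (t : ℝ) : EuclideanSpace ℝ (Fin d) :=
  (∑ j ∈ D.Nb t i, D.A i j (sol.x t) (sol.y t) t • (sol.x t j - sol.x t i)) +
    (∑ j ∈ D.Ld t i, D.B i j (sol.x t) (sol.y t) t • (sol.y t j - sol.x t i)) + sol.w i t

/-- In a direction `v`, the excess of the followers over a level `S` which dominates the leaders,
corrected by the accumulated disturbance, is a scalar flow. -/
theorem scalarFlow {v : EuclideanSpace ℝ (Fin d)} (hv : ‖v‖ ≤ 1) {t₀ t₁ S : ℝ} (ht₀ : 0 ≤ t₀)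
    (hS : ∀ t ∈ Ico t₀ t₁, ∀ j, inner ℝ v (sol.y t j) ≤ S) :
    ScalarFlow D D.pushRate D.pullRate t₀ t₁
      (fun i t => inner ℝ v (sol.x t i) - S - ∫ s in t₀..t, sol.wnorm s)
      (fun i t => inner ℝ v (sol.xVel i t) - sol.wnorm t) := by
  set f : Fin n → ℝ → ℝ := fun i t => inner ℝ v (sol.x t i) - S - ∫ s in t₀..t, sol.wnorm s
    with hf
  have hα := D.pullRate_pos
  have hprim : ∀ t, HasDerivAt (fun t => ∫ s in t₀..t, sol.wnorm s) (sol.wnorm t) t := fun t =>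
    intervalIntegral.integral_hasDerivAt_right (sol.continuous_wnorm.intervalIntegrable _ _)
      (sol.continuous_wnorm.stronglyMeasurableAtFilter _ _) sol.continuous_wnorm.continuousAt
  have hvel : ∀ i, ∀ t ∈ Ico t₀ t₁, inner ℝ v (sol.xVel i t) - sol.wnorm t ≤
      ∑ j ∈ D.Nb t i, D.A i j (sol.x t) (sol.y t) t * (f j t - f i t)
        + ∑ j ∈ D.Ld t i, D.B i j (sol.x t) (sol.y t) t * (-f i t) := by
    intro i t ht
    have hw : inner ℝ v (sol.w i t) ≤ sol.wnorm t :=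
      ((real_inner_le_norm _ _).trans (mul_le_of_le_one_left (norm_nonneg _) hv)).trans
        (sol.norm_w_le_wnorm i t)
    have hN : ∑ j ∈ D.Nb t i, D.A i j (sol.x t) (sol.y t) t * (f j t - f i t)
        = ∑ j ∈ D.Nb t i, D.A i j (sol.x t) (sol.y t) t *
          (inner ℝ v (sol.x t j) - inner ℝ v (sol.x t i)) :=
      Finset.sum_congr rfl fun j _ => by simp only [hf]; ring
    have hL : ∑ j ∈ D.Ld t i, D.B i j (sol.x t) (sol.y t) t *
          (inner ℝ v (sol.y t j) - inner ℝ v (sol.x t i))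
        ≤ ∑ j ∈ D.Ld t i, D.B i j (sol.x t) (sol.y t) t * (-f i t) := by
      refine Finset.sum_le_sum fun j _ => mul_le_mul_of_nonneg_left ?_
        (D.bLo_pos.trans_le (D.B_bdd _ _ _ _ _)).le
      have := hS t ht j
      have := sol.integral_wnorm_nonneg ht.1
      simp only [hf]
      linarith
    simp only [xVel, inner_add_right, inner_sum, real_inner_smul_right, inner_sub_right]
    linarith
  have hLd : ∀ i t, 0 ≤ f i t →
      ∑ j ∈ D.Ld t i, D.B i j (sol.x t) (sol.y t) t * (-f i t) ≤ 0 := fun i t h =>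
    Finset.sum_nonpos fun j _ => mul_nonpos_of_nonneg_of_nonpos
      (D.bLo_pos.trans_le (D.B_bdd _ _ _ _ _)).le (by linarith)
  refine ⟨fun i => ?_, fun i t ht => ?_, fun i t ht H hH h0 => ?_, fun q i t ht hq H hH h0 => ?_⟩
  · exact ((continuous_const.inner (sol.x_cont i)).sub continuous_const).sub
      (continuous_iff_continuousAt.2 fun t => (hprim t).continuousAt)
  · exact (((innerSL ℝ v).hasFDerivAt.comp_hasDerivWithinAt t
      (sol.dyn_x i t (ht₀.trans ht.1))).sub_const S).sub (hprim t).hasDerivWithinAt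
  · have h1 := hvel i t ht
    have h2 := D.sum_followers_le (xv := sol.x t) (yv := sol.y t) (t := t) (i := i) hH (D.Nb t i)
    have h3 := hLd i t h0
    have h4 : 0 ≤ D.pullRate * (H - f i t) := mul_nonneg hα.le (sub_nonneg.2 (hH i))
    have h5 : D.pushRate * (H - f i t)
        = n * D.aHi * (H - f i t) + D.pullRate * (H - f i t) := add_mul _ _ _
    linarith
  · have h1 := hvel i t ht
    have h4 : 0 ≤ D.pullRate * (H - f i t) := mul_nonneg hα.le (sub_nonneg.2 (hH i))
    have h5 : D.pushRate * (H - f i t)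
        = n * D.aHi * (H - f i t) + D.pullRate * (H - f i t) := add_mul _ _ _
    rcases q with q | q
    · have h2 := D.sum_followers_le (xv := sol.x t) (yv := sol.y t) (t := t) (i := i) hH
        (D.Nb t i)
      have h3 : ∑ j ∈ D.Ld t i, D.B i j (sol.x t) (sol.y t) t * (-f i t)
          ≤ D.B i q (sol.x t) (sol.y t) t * (-f i t) := by
        have := Finset.single_le_sum
          (f := fun j => D.B i j (sol.x t) (sol.y t) t * f i t) (fun j _ => mul_nonneg
            (D.bLo_pos.trans_le (D.B_bdd _ _ _ _ _)).le h0) (show q ∈ D.Ld t i from hq)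
        simpa only [mul_neg, Finset.sum_neg_distrib, neg_le_neg_iff] using this
      have h6 : D.pullRate * f i t ≤ D.B i q (sol.x t) (sol.y t) t * f i t :=
        mul_le_mul_of_nonneg_right ((min_le_right _ _).trans (D.B_bdd _ _ _ _ _)) h0
      simp only [Sum.elim_inl]
      linarith
    · have h2 := D.sum_followers_le_of_mem (xv := sol.x t) (yv := sol.y t) (t := t) (i := i) hH
        (show q ∈ D.Nb t i from hq)
      have h3 := hLd i t h0
      have h6 : D.pullRate * (H - f q t) ≤ D.aLo * (H - f q t) :=
        mul_le_mul_of_nonneg_right (min_le_left _ _) (sub_nonneg.2 (hH q))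
      simp only [Sum.elim_inr]
      linarith

theorem infDist_le_distL (i : Fin n) (t : ℝ) : infDist (sol.x t i) (sol.Lset t) ≤ sol.distL t :=
  le_ciSup (f := fun i => infDist (sol.x t i) (sol.Lset t)) (finite_range _).bddAbove i

theorem distL_nonneg (t : ℝ) : 0 ≤ sol.distL t := Real.iSup_nonneg fun _ => infDist_nonneg

/-- A bound on scalar flows transfers to the distance from the leader set, up to the input. -/
theorem distL_le_of_scalarFlow {t₀ t₁ H K : ℝ} (ht₀ : 0 ≤ t₀) (ht : t₀ ≤ t₁)
    (hH : sol.distL t₀ ≤ H) (hK : 0 ≤ K)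
    (hflow : ∀ f f' : Fin n → ℝ → ℝ, ScalarFlow D D.pushRate D.pullRate t₀ t₁ f f' →
      (∀ i, f i t₀ ≤ H) → ∀ i, f i t₁ ≤ K) :
    sol.distL t₁ ≤ K + 3 * ∫ t in t₀..t₁, sol.znorm t := by
  have : Nonempty (Fin n) := ⟨⟨0, by have := D.hn; omega⟩⟩
  have : Nonempty (Fin k) := ⟨⟨0, D.hk⟩⟩
  set δ := ∫ t in t₀..t₁, sol.znorm t
  have hδ : 0 ≤ δ := sol.integral_znorm_nonneg ht
  refine ciSup_le fun i => infDist_convexHull_le_of_forall_inner (by positivity) fun v hv => ?_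
  obtain ⟨j, hj⟩ := Finite.exists_max fun j => inner ℝ v (sol.y t₀ j)
  have hS : ∀ t ∈ Ico t₀ t₁, ∀ l, inner ℝ v (sol.y t l) ≤ inner ℝ v (sol.y t₀ j) + δ := by
    intro t htI l
    have h1 := sol.inner_y_sub_le hv.le ht₀ htI.1 l
    have h2 := intervalIntegral.integral_add_adjacent_intervals
      (sol.intervalIntegrable_znorm t₀ t) (sol.intervalIntegrable_znorm t t₁)
    have h3 := sol.integral_znorm_nonneg htI.2.le
    linarith [hj l]
  have hx := hflow _ _ (sol.scalarFlow hv.le ht₀ hS) (fun l => by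
    have h1 := inner_le_add_infDist_convexHull hv.le hj (sol.x t₀ l)
    have h2 := sol.infDist_le_distL l t₀
    unfold Lset at h2
    simp only [intervalIntegral.integral_same]
    linarith) i
  have hback := sol.inner_y_sub_le (v := -v) (by rw [norm_neg, hv]) ht₀ ht j
  have hw := sol.integral_wnorm_le ht
  simp only [inner_neg_left] at hback
  exact ⟨j, by linarith⟩

theorem distL_le_add_integral {t : ℝ} (ht : 0 ≤ t) :
    sol.distL t ≤ sol.distL 0 + 3 * ∫ s in (0 : ℝ)..t, sol.znorm s :=
  sol.distL_le_of_scalarFlow le_rfl ht le_rfl (sol.distL_nonneg 0) fun _ _ hf hinit i =>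
    hf.le_of_initial_le (sol.distL_nonneg 0) hinit t ⟨ht, le_rfl⟩ i

theorem exists_distL_contraction (hU : D.UJLC) : ∃ L c : ℝ, 0 < c ∧ c ≤ 1 ∧
    ∀ t₀ ≥ 0, ∀ H > 0, sol.distL t₀ ≤ H →
      sol.distL (t₀ + L) ≤ (1 - c) * H + 3 * ∫ s in t₀..(t₀ + L), sol.znorm s := by
  obtain ⟨T, hT, hconn⟩ := hU
  have hτ := D.τD_pos
  have hα := D.pullRate_pos
  have hακ := D.pullRate_le_pushRate
  have hκ := hα.trans_le hακ
  have hL : 0 ≤ T + 2 * D.τD := by linarith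
  set ρ := ScalarFlow.stageFactor D.pushRate D.pullRate D.τD (T + 2 * D.τD) with hρ
  have hρ0 : 0 < ρ := ScalarFlow.stageFactor_pos hα hκ hτ
  have hρ1 : ρ ≤ 1 := (ScalarFlow.stageFactor_le_exp hα hακ hτ hL).trans
    (Real.exp_le_one_iff.2 (by nlinarith))
  have hρn : ρ ^ n ≤ 1 := pow_le_one₀ hρ0.le hρ1
  refine ⟨n * (T + 2 * D.τD), ρ ^ n, pow_pos hρ0 n, hρn, fun t₀ ht₀ H hH hdist => ?_⟩
  exact sol.distL_le_of_scalarFlow ht₀ (le_add_of_nonneg_right (by positivity)) hdist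
    (mul_nonneg (sub_nonneg.2 hρn) hH.le) fun _ _ hf hinit i =>
      hf.le_contraction hα hακ hH hinit hT hconn ht₀ rfl i

end MASSol

/-- A nonnegative bounded function which contracts by a fixed factor over a fixed delay, up to a
vanishing error, tends to `0`. -/
theorem tendsto_zero_of_eventually_contraction {h e : ℝ → ℝ} {L c M : ℝ} (hc : 0 < c) (hc1 : c ≤ 1)
    (hpos : ∀ t, 0 ≤ h t) (hM : ∀ᶠ t in atTop, h t ≤ M)
    (he : Tendsto e atTop (nhds 0))
    (hstep : ∀ᶠ t in atTop, ∀ H > 0, h t ≤ H → h (t + L) ≤ (1 - c) * H + e t) :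
    Tendsto h atTop (nhds 0) := by
  have hbound : ∀ ε > 0, ∀ m : ℕ, ∀ᶠ t in atTop, h t ≤ (1 - c) ^ m * |M| + ε := by
    intro ε hε m
    induction m with
    | zero =>
      filter_upwards [hM] with t ht
      linarith [le_abs_self M]
    | succ m ih =>
      have hev : ∀ᶠ t in atTop, h (t + L) ≤ (1 - c) ^ (m + 1) * |M| + ε := by
        filter_upwards [ih, hstep, he.eventually_le_const (mul_pos hc hε)] with t h1 h2 h3
        have hH : 0 < (1 - c) ^ m * |M| + ε :=
          add_pos_of_nonneg_of_pos (mul_nonneg (pow_nonneg (sub_nonneg.2 hc1) m) (abs_nonneg M)) hε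
        refine (h2 _ hH h1).trans ?_
        rw [pow_succ']
        linarith
      filter_upwards [(tendsto_atTop_add_const_right atTop (-L) tendsto_id).eventually hev]
        with t ht
      simpa using ht
  have hgeo : Tendsto (fun m : ℕ => (1 - c) ^ m * |M|) atTop (nhds 0) := by
    simpa using (tendsto_pow_atTop_nhds_zero_of_lt_one (sub_nonneg.2 hc1)
      (by linarith : 1 - c < 1)).mul_const |M|
  refine tendsto_order.2 ⟨fun a ha => .of_forall fun t => ha.trans_le (hpos t), fun a ha => ?_⟩
  obtain ⟨m, hm⟩ := (hgeo.eventually_lt_const (half_pos ha)).exists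
  filter_upwards [hbound (a / 2) (half_pos ha) m] with t ht
  linarith

/-- **Corollary 3.**  If the combined input satisfies (C1):
`∫₀^∞ |z(t)| dt < ∞`, and `G_{σ(t)}` is UJLC, then system (5) achieves global
set tracking with respect to `ℒ(y(t))`. -/
theorem set_tracking_of_ujlc_C1 {d n k : ℕ} (D : MASData d n k) (hU : D.UJLC)
    (sol : MASSol D)
    (hC1 : MeasureTheory.IntegrableOn sol.znorm (Set.Ici 0) MeasureTheory.volume) :
    Filter.Tendsto sol.distL Filter.atTop (nhds 0) := by
  obtain ⟨L, c, hc, hc1, hcontr⟩ := sol.exists_distL_contraction hU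
  have hlim := intervalIntegral_tendsto_integral_Ioi 0 (hC1.mono_set Ioi_subset_Ici_self)
    tendsto_id
  have hlimL := hlim.comp (tendsto_atTop_add_const_right atTop L tendsto_id)
  have herr : Tendsto (fun t => 3 * ∫ s in t..(t + L), sol.znorm s) atTop (nhds 0) := by
    have hdiff := ((hlimL.sub hlim).const_mul 3)
    rw [sub_self, mul_zero] at hdiff
    refine hdiff.congr fun t => ?_
    have := intervalIntegral.integral_add_adjacent_intervals
      (sol.intervalIntegrable_znorm 0 t) (sol.intervalIntegrable_znorm t (t + L))
    simp only [Function.comp_apply, id]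
    linarith
  have hbdd : ∀ᶠ t in atTop,
      sol.distL t ≤ sol.distL 0 + 3 * ((∫ s in Ioi 0, sol.znorm s) + 1) := by
    filter_upwards [hlim.eventually_le_const (lt_add_one _), eventually_ge_atTop 0] with t h1 h2
    have := sol.distL_le_add_integral h2
    simp only [id] at h1
    linarith
  refine tendsto_zero_of_eventually_contraction (L := L) hc hc1 sol.distL_nonneg hbdd herr ?_
  filter_upwards [eventually_ge_atTop 0] with t ht
  exact hcontr t ht
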